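/- arXiv:1806.00245 — 2 statements merged into one kernel-verified Lean document; each statement's English description precedes it below -/
import Mathlib

section
/- Let ℓ ∈ ℕ and let K be the Legendre covariance kernel of degree ℓ. Then for every θ ∈ (0, π) and every φ ∈ ℝ, evaluating at the diagonal point θ₁ = θ₂ = θ, φ₁ = φ₂ = φ one has: (i) (1/sin θ) · ∂³K/∂φ₁∂θ₁∂θ₂ = 0; (ii) (1/sin²θ) · ∂³K/∂φ₁∂θ₁∂φ₂ = cot θ · P_ℓ'(1). -/
open Real MeasureTheory

/-- The `l`-th Legendre polynomial, via Rodrigues' formula. -/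
noncomputable def legendre (l : ℕ) : ℝ → ℝ :=
  fun t => (1 / (2 ^ l * (Nat.factorial l : ℝ))) * iteratedDeriv l (fun s => (s ^ 2 - 1) ^ l) t

/-- The Legendre covariance kernel of degree `l`. -/
noncomputable def legendreKernel (l : ℕ) (θ₁ φ₁ θ₂ φ₂ : ℝ) : ℝ :=
  legendre l (Real.cos θ₁ * Real.cos θ₂ + Real.sin θ₁ * Real.sin θ₂ * Real.cos (φ₁ - φ₂))

open scoped ContDiff

theorem contDiff_legendre (l : ℕ) : ContDiff ℝ ∞ (legendre l) := by
  have h : ContDiff ℝ ∞ (fun s : ℝ => (s ^ 2 - 1) ^ l) := by fun_prop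
  have h' := h.iterate_deriv l
  rw [← iteratedDeriv_eq_iterate] at h'
  exact contDiff_const.mul h'

theorem deriv_legendreKernel_phi (l : ℕ) (θ₁ φ₁ θ₂ φ₂ : ℝ) :
    deriv (fun φ => legendreKernel l θ₁ φ θ₂ φ₂) φ₁ =
      -sin (φ₁ - φ₂) * (sin θ₁ * sin θ₂ *
        deriv (legendre l) (cos θ₁ * cos θ₂ + sin θ₁ * sin θ₂ * cos (φ₁ - φ₂))) := by
  have hP := (((contDiff_legendre l).differentiable (by simp))
    (cos θ₁ * cos θ₂ + sin θ₁ * sin θ₂ * cos (φ₁ - φ₂))).hasDerivAt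
  have hu : HasDerivAt (fun φ => cos θ₁ * cos θ₂ + sin θ₁ * sin θ₂ * cos (φ - φ₂))
      (sin θ₁ * sin θ₂ * (-sin (φ₁ - φ₂) * 1)) φ₁ :=
    ((((hasDerivAt_id φ₁).sub_const φ₂).cos).const_mul _).const_add _
  refine ((hP.comp φ₁ hu).deriv).trans ?_
  ring

theorem deriv_theta_deriv_legendreKernel_phi (l : ℕ) (θ₁ φ₁ θ₂ φ₂ : ℝ) :
    deriv (fun θ => deriv (fun φ => legendreKernel l θ φ θ₂ φ₂) φ₁) θ₁ =
      -sin (φ₁ - φ₂) * (cos θ₁ * sin θ₂ *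
        deriv (legendre l) (cos θ₁ * cos θ₂ + sin θ₁ * sin θ₂ * cos (φ₁ - φ₂)) +
        sin θ₁ * sin θ₂ *
        (deriv (deriv (legendre l)) (cos θ₁ * cos θ₂ + sin θ₁ * sin θ₂ * cos (φ₁ - φ₂)) *
          (-sin θ₁ * cos θ₂ + cos θ₁ * sin θ₂ * cos (φ₁ - φ₂)))) := by
  have hP := (((contDiff_legendre l).iterate_deriv 1).differentiable (by simp)
    (cos θ₁ * cos θ₂ + sin θ₁ * sin θ₂ * cos (φ₁ - φ₂))).hasDerivAt
  have hu : HasDerivAt (fun θ => cos θ * cos θ₂ + sin θ * sin θ₂ * cos (φ₁ - φ₂))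
      (-sin θ₁ * cos θ₂ + cos θ₁ * sin θ₂ * cos (φ₁ - φ₂)) θ₁ :=
    ((hasDerivAt_cos θ₁).mul_const _).add (((hasDerivAt_sin θ₁).mul_const _).mul_const _)
  simp only [deriv_legendreKernel_phi]
  exact ((((hasDerivAt_sin θ₁).mul_const _).mul (hP.comp θ₁ hu)).const_mul _).deriv

theorem stmt2 (l : ℕ) (θ φ : ℝ) (hθ : θ ∈ Set.Ioo 0 Real.pi) :
    (1 / Real.sin θ) *
      deriv (fun θ₂ => deriv (fun θ₁ => deriv (fun φ₁ => legendreKernel l θ₁ φ₁ θ₂ φ) φ) θ) θ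
      = 0 ∧
    (1 / Real.sin θ ^ 2) *
      deriv (fun φ₂ => deriv (fun θ₁ => deriv (fun φ₁ => legendreKernel l θ₁ φ₁ θ φ₂) φ) θ) φ
      = (Real.cos θ / Real.sin θ) * deriv (legendre l) 1 := by
  have hs : sin θ ≠ 0 := (sin_pos_of_mem_Ioo hθ).ne'
  simp only [deriv_theta_deriv_legendreKernel_phi]
  refine ⟨by simp, ?_⟩
  have h1 : Differentiable ℝ (deriv (legendre l)) :=
    ((contDiff_legendre l).iterate_deriv 1).differentiable (by simp)
  have h2 : Differentiable ℝ (deriv (deriv (legendre l))) :=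
    ((contDiff_legendre l).iterate_deriv 2).differentiable (by simp)
  have hf : HasDerivAt (fun φ₂ => -sin (φ - φ₂)) (-(cos (φ - φ) * -1)) φ :=
    (((hasDerivAt_id φ).const_sub φ).sin).neg
  have hone : cos θ * cos θ + sin θ * sin θ = 1 := by
    linarith [sin_sq_add_cos_sq θ]
  rw [deriv_fun_mul hf.differentiableAt (by fun_prop), hf.deriv]
  simp only [sub_self, cos_zero, sin_zero, mul_one, hone]
  field_simp
  ring
end

section
/- Let ℓ ∈ ℕ and let K be the Legendre covariance kernel of degree ℓ. Then for every θ ∈ (0, π) and every φ ∈ ℝ, evaluating at the diagonal point θ₁ = θ₂ = θ, φ₁ = φ₂ = φ one has (1/sin⁴θ) · ∂⁴K/∂φ₁²∂φ₂² = 3 P_ℓ''(1) + P_ℓ'(1) + cot²θ · P_ℓ'(1). -/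
open Real MeasureTheory

theorem legendre_eq_polynomial_eval (l : ℕ) :
    ∃ p : Polynomial ℝ, legendre l = fun t => p.eval t := by
  refine ⟨.C (1 / (2 ^ l * (Nat.factorial l : ℝ))) *
    Polynomial.derivative^[l] ((.X ^ 2 - 1) ^ l), ?_⟩
  have iteratedDeriv_eval (q : Polynomial ℝ) (n : ℕ) :
      iteratedDeriv n (fun x => q.eval x) = fun x => (Polynomial.derivative^[n] q).eval x := by
    induction n with
    | zero => simp
    | succ n ih =>
      rw [iteratedDeriv_succ, ih, Function.iterate_succ_apply']
      funext x
      exact Polynomial.deriv _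
  funext t
  have h := congrFun (iteratedDeriv_eval ((.X ^ 2 - 1) ^ l) l) t
  simp only [Polynomial.eval_pow, Polynomial.eval_sub, Polynomial.eval_X, Polynomial.eval_one] at h
  simp only [legendre, h, Polynomial.eval_mul, Polynomial.eval_C]

theorem iteratedDeriv_two_eq {f g h : ℝ → ℝ} (hf : ∀ x, HasDerivAt f (g x) x)
    (hg : ∀ x, HasDerivAt g (h x) x) : iteratedDeriv 2 f = h := by
  rw [iteratedDeriv_succ, iteratedDeriv_one, funext fun x => (hf x).deriv]
  exact funext fun x => (hg x).deriv

theorem hasDerivAt_eval_add_mul_cos (p : Polynomial ℝ) (a b u : ℝ) :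
    HasDerivAt (fun u => p.eval (a + b * cos u))
      (-(b * sin u) * p.derivative.eval (a + b * cos u)) u := by
  have h := (p.hasDerivAt (a + b * cos u)).comp u (((hasDerivAt_cos u).const_mul b).const_add a)
  exact h.congr_deriv (by ring)

/-- The second derivative of `u ↦ p (a + b cos u)`. -/
theorem iteratedDeriv_two_eval_add_mul_cos (p : Polynomial ℝ) (a b : ℝ) :
    iteratedDeriv 2 (fun u => p.eval (a + b * cos u)) = fun u =>
      -(b * cos u) * p.derivative.eval (a + b * cos u) +
        b ^ 2 * sin u ^ 2 * p.derivative.derivative.eval (a + b * cos u) := by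
  refine iteratedDeriv_two_eq (hasDerivAt_eval_add_mul_cos p a b) fun u => ?_
  exact (((hasDerivAt_sin u).const_mul b).neg.mul
    (hasDerivAt_eval_add_mul_cos p.derivative a b u)).congr_deriv (by simp only [Pi.neg_apply]; ring)

/-- The fourth derivative of `u ↦ p (a + b cos u)` at `0`. -/
theorem iteratedDeriv_two_iteratedDeriv_two_eval_add_mul_cos_zero (p : Polynomial ℝ) (a b : ℝ) :
    iteratedDeriv 2 (iteratedDeriv 2 fun u => p.eval (a + b * cos u)) 0 =
      3 * b ^ 2 * p.derivative.derivative.eval (a + b) + b * p.derivative.eval (a + b) := by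
  rw [iteratedDeriv_two_eval_add_mul_cos]
  have hp := hasDerivAt_eval_add_mul_cos
  refine (congrFun (iteratedDeriv_two_eq
    (fun u => (((hasDerivAt_cos u).const_mul b).neg.mul (hp p.derivative a b u)).add
      ((((hasDerivAt_sin u).pow 2).const_mul (b ^ 2)).mul (hp p.derivative.derivative a b u)))
    (h := fun u =>
      b * cos u * p.derivative.eval (a + b * cos u)
      + b * sin u * (-(b * sin u) * p.derivative.derivative.eval (a + b * cos u))
      + 3 * b ^ 2 * ((cos u * cos u - sin u * sin u) *
          p.derivative.derivative.eval (a + b * cos u)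
        + sin u * cos u * (-(b * sin u) *
          p.derivative.derivative.derivative.eval (a + b * cos u)))
      - b ^ 3 * (3 * sin u ^ 2 * cos u *
          p.derivative.derivative.derivative.eval (a + b * cos u)
        + sin u ^ 3 * (-(b * sin u) *
          p.derivative.derivative.derivative.derivative.eval (a + b * cos u)))) ?_) 0).trans ?_
  · intro u
    have h1 := (((hasDerivAt_sin u).const_mul b).mul (hp p.derivative a b u))
    have h2 := (((hasDerivAt_sin u).mul (hasDerivAt_cos u)).mul
      (hp p.derivative.derivative a b u)).const_mul (3 * b ^ 2)
    have h3 := (((hasDerivAt_sin u).pow 3).mul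
      (hp p.derivative.derivative.derivative a b u)).const_mul (b ^ 3)
    refine (((h1.add h2).sub h3).congr_of_eventuallyEq (.of_forall fun v => ?_)).congr_deriv ?_
    · simp; ring
    · simp only [Pi.mul_apply, Pi.pow_apply, Nat.cast_ofNat, Nat.reduceSub]; ring
  · simp; ring

theorem stmt7 (l : ℕ) (θ φ : ℝ) (hθ : θ ∈ Set.Ioo 0 Real.pi) :
    (1 / Real.sin θ ^ 4) *
      iteratedDeriv 2 (fun φ₂ => iteratedDeriv 2 (fun φ₁ => legendreKernel l θ φ₁ θ φ₂) φ) φ =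
      3 * iteratedDeriv 2 (legendre l) 1 + deriv (legendre l) 1 +
        (Real.cos θ / Real.sin θ) ^ 2 * deriv (legendre l) 1 := by
  obtain ⟨p, hp⟩ := legendre_eq_polynomial_eval l
  have hs : sin θ ≠ 0 := (sin_pos_of_mem_Ioo hθ).ne'
  have hc : cos θ * cos θ + sin θ * sin θ = 1 := by nlinarith [sin_sq_add_cos_sq θ]
  set F : ℝ → ℝ := fun u => p.eval (cos θ * cos θ + sin θ * sin θ * cos u) with hF
  have hK (x y : ℝ) : legendreKernel l θ x θ y = F (x - y) := by simp [legendreKernel, hp, hF]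
  have h_inner (y : ℝ) : iteratedDeriv 2 (fun x => F (x - y)) φ = iteratedDeriv 2 F (φ - y) :=
    congrFun (iteratedDeriv_comp_sub_const 2 F y) φ
  have h_outer : iteratedDeriv 2 (fun y => iteratedDeriv 2 F (φ - y)) φ =
      iteratedDeriv 2 (iteratedDeriv 2 F) 0 := by
    rw [iteratedDeriv_comp_const_sub]
    simp
  have hp2 : iteratedDeriv 2 (fun t => p.eval t) = fun t => p.derivative.derivative.eval t :=
    iteratedDeriv_two_eq p.hasDerivAt p.derivative.hasDerivAt
  simp only [hK, h_inner, h_outer]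
  rw [hF, iteratedDeriv_two_iteratedDeriv_two_eval_add_mul_cos_zero, hc, hp, hp2, Polynomial.deriv]
  field_simp
  linear_combination -(Polynomial.eval 1 p.derivative) * hc
end
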